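/- arXiv:1711.04183 — 2 statements merged into one kernel-verified Lean document; each statement's English description precedes it below -/
import Mathlib

section
/- If n is a positive integer and k is a prime (with k ≥ 3), then r_k(n)·(k−1) ≤ r_k(n·k). -/
/-- A set `S` of natural numbers contains a `k`-term arithmetic progression:
there are `a` and `d ≥ 1` with `a, a+d, …, a+(k-1)d` all in `S`. -/
def HasAP (k : ℕ) (S : Set ℕ) : Prop :=
  ∃ a d : ℕ, 1 ≤ d ∧ ∀ i < k, a + i * d ∈ S

/-- `rk k n` is the maximum size of a `k`-AP-free subset of `{1, …, n}`. -/
noncomputable def rk (k n : ℕ) : ℕ :=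
  sSup {m | ∃ A : Finset ℕ, A ⊆ Finset.Icc 1 n ∧ ¬ HasAP k ↑A ∧ A.card = m}

/-- A progression of prime length `k` whose difference is not divisible by `k` meets `k ℤ`. -/
lemma exists_lt_dvd_add_mul {k a d : ℕ} (hk : k.Prime) (hd : ¬ k ∣ d) :
    ∃ i < k, k ∣ a + i * d := by
  have : Fact k.Prime := ⟨hk⟩
  have hd' : (d : ZMod k) ≠ 0 := by rwa [Ne, ZMod.natCast_eq_zero_iff]
  refine ⟨(-(a : ZMod k) / d).val, ZMod.val_lt _, ?_⟩
  rw [← ZMod.natCast_eq_zero_iff]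
  push_cast
  rw [ZMod.natCast_zmod_val, div_mul_cancel₀ _ hd', add_neg_cancel]

/-- Replace each `a ∈ A` by the `k - 1` non-multiples of `k` in the `a`-th block of length `k`. -/
def blowUp (k : ℕ) (A : Finset ℕ) : Finset ℕ :=
  (A ×ˢ Finset.Icc 1 (k - 1)).image fun p => k * (p.1 - 1) + p.2

lemma mod_ne_zero_and_div_mem_of_mem_blowUp {k x : ℕ} {A : Finset ℕ} (hk : 0 < k)
    (hA : ∀ a ∈ A, 1 ≤ a) (hx : x ∈ blowUp k A) : x % k ≠ 0 ∧ x / k + 1 ∈ A := by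
  simp only [blowUp, Finset.mem_image, Finset.mem_product, Finset.mem_Icc, Prod.exists] at hx
  obtain ⟨a, j, ⟨ha, hj1, hj2⟩, rfl⟩ := hx
  have hjk : j < k := by omega
  rw [Nat.mul_add_mod, Nat.mod_eq_of_lt hjk, Nat.mul_add_div hk, Nat.div_eq_of_lt hjk, add_zero,
    Nat.sub_add_cancel (hA a ha)]
  exact ⟨by omega, ha⟩

lemma card_blowUp {k : ℕ} {A : Finset ℕ} (hk : 0 < k) (hA : ∀ a ∈ A, 1 ≤ a) :
    (blowUp k A).card = A.card * (k - 1) := by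
  rw [blowUp, Finset.card_image_of_injOn, Finset.card_product, Nat.card_Icc, Nat.add_sub_cancel]
  rintro ⟨a, i⟩ hp ⟨b, j⟩ hq h
  simp only [Finset.coe_product, Set.mem_prod, Finset.mem_coe, Finset.mem_Icc] at hp hq h
  have hik : i < k := by omega
  have hjk : j < k := by omega
  have hmod := congrArg (· % k) h
  have hdiv := congrArg (· / k) h
  simp only [Nat.mul_add_mod, Nat.mod_eq_of_lt hik, Nat.mod_eq_of_lt hjk] at hmod
  simp only [Nat.mul_add_div hk, Nat.div_eq_of_lt hik, Nat.div_eq_of_lt hjk] at hdiv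
  have := hA a hp.1
  have := hA b hq.1
  ext
  · dsimp only
    omega
  · exact hmod

lemma blowUp_subset_Icc {k n : ℕ} {A : Finset ℕ} (hA : A ⊆ Finset.Icc 1 n) :
    blowUp k A ⊆ Finset.Icc 1 (n * k) := by
  intro x hx
  simp only [blowUp, Finset.mem_image, Finset.mem_product, Finset.mem_Icc, Prod.exists] at hx
  obtain ⟨a, j, ⟨ha, hj1, hj2⟩, rfl⟩ := hx
  obtain ⟨ha1, han⟩ := Finset.mem_Icc.1 (hA ha)
  obtain ⟨b, rfl⟩ := Nat.exists_eq_add_of_le' ha1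
  have : k * (b + 1) ≤ k * n := Nat.mul_le_mul_left k han
  rw [Finset.mem_Icc, Nat.add_sub_cancel, mul_comm n k]
  rw [mul_add, mul_one] at this
  omega

lemma not_hasAP_blowUp {k : ℕ} {A : Finset ℕ} (hk : k.Prime) (hA : ∀ a ∈ A, 1 ≤ a)
    (hAP : ¬ HasAP k (A : Set ℕ)) : ¬ HasAP k (blowUp k A : Set ℕ) := by
  rintro ⟨a, d, hd, h⟩
  have hmem i (hi : i < k) := mod_ne_zero_and_div_mem_of_mem_blowUp hk.pos hA (h i hi)
  by_cases hkd : k ∣ d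
  · obtain ⟨e, rfl⟩ := hkd
    refine hAP ⟨a / k + 1, e, Nat.pos_of_mul_pos_left hd, fun i hi => ?_⟩
    have := (hmem i hi).2
    rwa [mul_left_comm, Nat.add_mul_div_left _ _ hk.pos, add_right_comm] at this
  · obtain ⟨i, hi, hdvd⟩ := exists_lt_dvd_add_mul (a := a) hk hkd
    exact (hmem i hi).1 (Nat.mod_eq_zero_of_dvd hdvd)

lemma bddAbove_card_of_not_hasAP (k n : ℕ) :
    BddAbove {m | ∃ A : Finset ℕ, A ⊆ Finset.Icc 1 n ∧ ¬ HasAP k ↑A ∧ A.card = m} := by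
  refine ⟨(Finset.Icc 1 n).card, ?_⟩
  rintro m ⟨A, hA, -, rfl⟩
  exact Finset.card_le_card hA

lemma exists_card_eq_rk {k : ℕ} (n : ℕ) (hk : 0 < k) :
    ∃ A : Finset ℕ, A ⊆ Finset.Icc 1 n ∧ ¬ HasAP k (A : Set ℕ) ∧ A.card = rk k n :=
  Nat.sSup_mem (s := {m | ∃ A : Finset ℕ, A ⊆ Finset.Icc 1 n ∧ ¬ HasAP k ↑A ∧ A.card = m})
    ⟨0, ∅, Finset.empty_subset _, fun ⟨_, _, _, h⟩ => by simpa using h 0 hk, rfl⟩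
    (bddAbove_card_of_not_hasAP k n)

theorem rk_recursive (k n : ℕ) (hn : 1 ≤ n) (hk : k.Prime) (hk3 : 3 ≤ k) :
    rk k n * (k - 1) ≤ rk k (n * k) := by
  obtain ⟨A, hA, hAP, hcard⟩ := exists_card_eq_rk n hk.pos
  have hA1 : ∀ a ∈ A, 1 ≤ a := fun a ha => (Finset.mem_Icc.1 (hA ha)).1
  rw [← hcard, ← card_blowUp hk.pos hA1]
  exact le_csSup (bddAbove_card_of_not_hasAP k (n * k))
    ⟨blowUp k A, blowUp_subset_Icc hA, not_hasAP_blowUp hk hA1 hAP, rfl⟩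
end

section
/- Let k be a prime with k ≥ 3 and set c_k = k·ln(k/(k−1)). Then for every integer n ≥ 2, n^(1 − c_k/(k·ln k)) ≤ r_k(n). -/
/-- No base-`k` digit of `x` equals `k - 1`. -/
def AvoidsTopDigit (k x : ℕ) : Prop :=
  ∀ j, x / k ^ j % k ≠ k - 1

lemma avoidsTopDigit_mul_pow_add_iff {k m c x : ℕ} (hc : c < k - 1) (hx : x < k ^ m) :
    AvoidsTopDigit k (c * k ^ m + x) ↔ AvoidsTopDigit k x := by
  have hk : 0 < k := by omega
  have low (j : ℕ) (hj : j < m) : (c * k ^ m + x) / k ^ j % k = x / k ^ j % k := by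
    obtain ⟨t, rfl⟩ := Nat.exists_eq_add_of_lt hj
    have h : c * k ^ (j + t + 1) + x = x + k ^ j * (k * (c * k ^ t)) := by ring
    rw [h, Nat.add_mul_div_left _ _ (by positivity), Nat.add_mul_mod_self_left]
  have top (y j : ℕ) (hj : m ≤ j) (hy : y / k ^ m < k - 1) : y / k ^ j % k ≠ k - 1 := by
    have h₁ : y / k ^ j ≤ y / k ^ m :=
      Nat.div_le_div_left (Nat.pow_le_pow_right hk hj) (by positivity)
    have h₂ := Nat.mod_le (y / k ^ j) k
    omega
  have hlead : (c * k ^ m + x) / k ^ m = c := by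
    rw [mul_comm, Nat.mul_add_div (by positivity), Nat.div_eq_of_lt hx, add_zero]
  constructor <;> intro h j <;> rcases lt_or_ge j m with hj | hj
  · exact low j hj ▸ h j
  · exact top _ j hj (by rw [Nat.div_eq_of_lt hx]; omega)
  · exact (low j hj).symm ▸ h j
  · exact top _ j hj (by rwa [hlead])

open Classical in
lemma count_avoidsTopDigit_mul_pow_add {k m c s : ℕ} (hc : c < k - 1) (hs : s ≤ k ^ m) :
    Nat.count (AvoidsTopDigit k) (c * k ^ m + s)
      = Nat.count (AvoidsTopDigit k) (c * k ^ m) + Nat.count (AvoidsTopDigit k) s := by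
  rw [Nat.count_add]
  congr 1
  simp only [Nat.count_eq_card_filter_range]
  congr 1
  apply Finset.filter_congr
  intro x hx
  exact avoidsTopDigit_mul_pow_add_iff hc ((Finset.mem_range.mp hx).trans_le hs)

open Classical in
lemma count_avoidsTopDigit_mul_pow {k m c : ℕ} (hc : c ≤ k - 1) :
    Nat.count (AvoidsTopDigit k) (c * k ^ m) = c * Nat.count (AvoidsTopDigit k) (k ^ m) := by
  induction c with
  | zero => simp
  | succ c ih =>
    rw [add_mul, one_mul, count_avoidsTopDigit_mul_pow_add (by omega) le_rfl, ih (by omega)]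
    ring

open Classical in
lemma pow_le_count_avoidsTopDigit {k : ℕ} (hk : 2 ≤ k) (m : ℕ) :
    (k - 1) ^ m ≤ Nat.count (AvoidsTopDigit k) (k ^ m) := by
  induction m with
  | zero =>
    have h : AvoidsTopDigit k 0 := fun j => by simp; omega
    rw [pow_zero, pow_zero, ← zero_add 1, Nat.count_succ, if_pos h]
    exact Nat.le_add_left _ _
  | succ m ih =>
    calc (k - 1) ^ (m + 1) = (k - 1) * (k - 1) ^ m := by ring
      _ ≤ (k - 1) * Nat.count (AvoidsTopDigit k) (k ^ m) := by gcongr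
      _ = Nat.count (AvoidsTopDigit k) ((k - 1) * k ^ m) :=
        (count_avoidsTopDigit_mul_pow le_rfl).symm
      _ ≤ Nat.count (AvoidsTopDigit k) (k ^ (m + 1)) := by
        apply Nat.count_monotone
        rw [pow_succ']
        exact Nat.mul_le_mul_right _ (Nat.sub_le _ _)

open Classical in
lemma rpow_le_count_avoidsTopDigit {k : ℕ} (hk : 2 ≤ k) {α : ℝ} (hα₀ : 0 < α) (hα₁ : α ≤ 1)
    (hα : (k : ℝ) ^ α = (k : ℝ) - 1) (n : ℕ) :
    (n : ℝ) ^ α ≤ Nat.count (AvoidsTopDigit k) n := by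
  have hcast : ((k - 1 : ℕ) : ℝ) = (k : ℝ) - 1 := by
    rw [Nat.cast_sub (by omega), Nat.cast_one]
  have hpow (m : ℕ) : ((k : ℝ) ^ m) ^ α = ((k - 1 : ℕ) : ℝ) ^ m := by
    rw [hcast, ← hα, ← Real.rpow_natCast, ← Real.rpow_mul (by positivity), mul_comm,
      Real.rpow_mul (by positivity), Real.rpow_natCast]
  induction n using Nat.strong_induction_on with
  | _ n ih =>
  rcases Nat.eq_zero_or_pos n with rfl | hn
  · simp [Real.zero_rpow hα₀.ne']
  set m := Nat.log k n
  have hm : k ^ m ≤ n := Nat.pow_log_le_self k hn.ne'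
  have hm' : n < k ^ (m + 1) := Nat.lt_pow_succ_log_self (by omega) n
  have hkm : 0 < k ^ m := by positivity
  set c := n / k ^ m
  set s := n % k ^ m
  have hns : n = c * k ^ m + s := (Nat.div_add_mod' n (k ^ m)).symm
  have hs : s < k ^ m := Nat.mod_lt _ hkm
  have hc : 1 ≤ c := (Nat.one_le_div_iff hkm).mpr hm
  rcases lt_or_ge c (k - 1) with hck | hck
  · have hcount : c * (k - 1) ^ m + Nat.count (AvoidsTopDigit k) s
        ≤ Nat.count (AvoidsTopDigit k) n := by
      rw [hns, count_avoidsTopDigit_mul_pow_add hck hs.le, count_avoidsTopDigit_mul_pow hck.le]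
      gcongr
      exact pow_le_count_avoidsTopDigit hk m
    have hc_rpow : (c : ℝ) ^ α ≤ c :=
      Real.rpow_le_self_of_one_le (by exact_mod_cast hc) hα₁
    calc (n : ℝ) ^ α = ((c : ℝ) * (k : ℝ) ^ m + s) ^ α := by
          congr 1
          exact_mod_cast hns
      _ ≤ ((c : ℝ) * (k : ℝ) ^ m) ^ α + (s : ℝ) ^ α :=
          Real.rpow_add_le_add_rpow (by positivity) (by positivity) hα₀.le hα₁
      _ = (c : ℝ) ^ α * ((k - 1 : ℕ) : ℝ) ^ m + (s : ℝ) ^ α := by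
          rw [Real.mul_rpow (by positivity) (by positivity), hpow]
      _ ≤ (c : ℝ) * ((k - 1 : ℕ) : ℝ) ^ m + Nat.count (AvoidsTopDigit k) s := by
          gcongr
          exact ih s (hs.trans_le hm)
      _ ≤ Nat.count (AvoidsTopDigit k) n := by exact_mod_cast hcount
  · calc (n : ℝ) ^ α ≤ ((k : ℝ) ^ (m + 1)) ^ α := by
          apply Real.rpow_le_rpow (by positivity) (by exact_mod_cast hm'.le) hα₀.le
      _ = (((k - 1) * (k - 1) ^ m : ℕ) : ℝ) := by
          rw [hpow]
          push_cast
          ring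
      _ ≤ Nat.count (AvoidsTopDigit k) n := by
          norm_cast
          calc (k - 1) * (k - 1) ^ m ≤ (k - 1) * Nat.count (AvoidsTopDigit k) (k ^ m) := by
                gcongr
                exact pow_le_count_avoidsTopDigit hk m
            _ = Nat.count (AvoidsTopDigit k) ((k - 1) * k ^ m) :=
                (count_avoidsTopDigit_mul_pow le_rfl).symm
            _ ≤ Nat.count (AvoidsTopDigit k) n := by
                apply Nat.count_monotone
                rw [hns]
                exact (Nat.mul_le_mul_right _ hck).trans (Nat.le_add_right _ _)

lemma exists_lt_not_avoidsTopDigit {k : ℕ} (hk : k.Prime) (a : ℕ) {d : ℕ} (hd : d ≠ 0) :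
    ∃ i < k, ¬ AvoidsTopDigit k (a + i * d) := by
  have : Fact k.Prime := ⟨hk⟩
  obtain ⟨j, u, hu, rfl⟩ := Nat.exists_eq_pow_mul_and_not_dvd hd k hk.ne_one
  have hu₀ : (u : ZMod k) ≠ 0 := by rwa [Ne, ZMod.natCast_eq_zero_iff]
  set b := a / k ^ j
  set z : ZMod k := (((k - 1 : ℕ) : ZMod k) - b) / u
  refine ⟨z.val, z.val_lt, fun h => h j ?_⟩
  have hdiv : (a + z.val * (k ^ j * u)) / k ^ j = b + z.val * u := by
    rw [show z.val * (k ^ j * u) = k ^ j * (z.val * u) by ring,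
      Nat.add_mul_div_left _ _ (pow_pos hk.pos j)]
  have hmod : ((b + z.val * u : ℕ) : ZMod k) = ((k - 1 : ℕ) : ZMod k) := by
    rw [Nat.cast_add, Nat.cast_mul, ZMod.natCast_zmod_val, div_mul_cancel₀ _ hu₀]
    ring
  rw [hdiv, (ZMod.natCast_eq_natCast_iff' _ _ _).mp hmod,
    Nat.mod_eq_of_lt (Nat.sub_lt hk.pos one_pos)]

lemma card_le_rk {k n : ℕ} {A : Finset ℕ} (hA : A ⊆ Finset.Icc 1 n) (hAP : ¬ HasAP k ↑A) :
    A.card ≤ rk k n := by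
  refine le_csSup ⟨n, ?_⟩ ⟨A, hA, hAP, rfl⟩
  rintro _ ⟨B, hB, -, rfl⟩
  simpa using Finset.card_le_card hB

open Classical in
lemma count_avoidsTopDigit_le_rk {k : ℕ} (hk : k.Prime) (n : ℕ) :
    Nat.count (AvoidsTopDigit k) n ≤ rk k n := by
  rw [Nat.count_eq_card_filter_range,
    ← Finset.card_image_of_injective _ (add_left_injective 1)]
  apply card_le_rk
  · intro x hx
    simp only [Finset.mem_image, Finset.mem_filter, Finset.mem_range] at hx
    obtain ⟨y, ⟨hy, -⟩, rfl⟩ := hx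
    simp only [Finset.mem_Icc]
    omega
  · rintro ⟨a, d, hd, h⟩
    simp only [Finset.coe_image, Finset.coe_filter, Set.mem_image, Set.mem_ofPred_eq,
      Finset.mem_range] at h
    obtain ⟨a', -, ha'⟩ := h 0 hk.pos
    obtain ⟨i, hi, hi'⟩ := exists_lt_not_avoidsTopDigit hk a' (by omega : d ≠ 0)
    obtain ⟨y, ⟨-, hy⟩, hy'⟩ := h i hi
    exact hi' ((by omega : y = a' + i * d) ▸ hy)

theorem rk_main_lower_bound (k : ℕ) (hk : k.Prime) (hk3 : 3 ≤ k) :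
    ∀ n : ℕ, 2 ≤ n →
      (n : ℝ) ^ (1 - ((k : ℝ) * Real.log ((k : ℝ) / ((k : ℝ) - 1))) / ((k : ℝ) * Real.log k))
        ≤ (rk k n : ℝ) := by
  intro n _
  have hk₃ : (3 : ℝ) ≤ k := by exact_mod_cast hk3
  have hlog : 0 < Real.log k := Real.log_pos (by linarith)
  have hexp : 1 - ((k : ℝ) * Real.log ((k : ℝ) / ((k : ℝ) - 1))) / ((k : ℝ) * Real.log k)
      = Real.log ((k : ℝ) - 1) / Real.log k := by
    rw [mul_div_mul_left _ _ (by positivity), Real.log_div (by positivity) (by linarith)]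
    field_simp
    ring
  rw [hexp]
  have hα₀ : 0 < Real.log ((k : ℝ) - 1) / Real.log k :=
    div_pos (Real.log_pos (by linarith)) hlog
  have hα₁ : Real.log ((k : ℝ) - 1) / Real.log k ≤ 1 :=
    (div_le_one hlog).mpr (Real.log_le_log (by linarith) (by linarith))
  have hα : (k : ℝ) ^ (Real.log ((k : ℝ) - 1) / Real.log k) = (k : ℝ) - 1 := by
    rw [Real.rpow_def_of_pos (by positivity), mul_div_cancel₀ _ hlog.ne',
      Real.exp_log (by linarith)]
  classical
  exact (rpow_le_count_avoidsTopDigit (by omega) hα₀ hα₁ hα n).trans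
    (by exact_mod_cast count_avoidsTopDigit_le_rk hk n)
end
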